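/- GSp6(k) is the disjoint union over σ ∈ Σ = {1, b, b·c·b, b·a·c·b, b·c·a·b·a·c·b} of the sets Sᵀ·η(GL2)·σ·η(GL2)·S; that is, every g ∈ GSp6(k) can be written g = sᵀ·η(u)·σ·η(v)·t with s, t ∈ S and u, v ∈ GL2(k) for exactly one σ ∈ Σ. -/

import Mathlib

open Matrix Pointwise

/-- 2×2 matrices over `k`. -/
abbrev M2 (k : Type*) [Field k] := Matrix (Fin 2) (Fin 2) k

/-- 6×6 matrices over `k`. -/
abbrev M6 (k : Type*) [Field k] := Matrix (Fin 6) (Fin 6) k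

variable {k : Type*} [Field k]

/-- The 2×2 matrix `J = [[0,-1],[1,0]]`. -/
def Jmat : M2 k := !![0, -1; 1, 0]

/-- Build a 6×6 matrix from a 3×3 array of 2×2 blocks. -/
def blk (M : Fin 3 → Fin 3 → M2 k) : M6 k :=
  Matrix.of fun i j =>
    M ⟨i.val / 2, by have := i.isLt; omega⟩ ⟨j.val / 2, by have := j.isLt; omega⟩
      ⟨i.val % 2, by have := i.isLt; omega⟩ ⟨j.val % 2, by have := j.isLt; omega⟩

/-- Block diagonal 6×6 matrix with 2×2 blocks `g`, `h`, `m`. -/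
def bdiag (g h m : M2 k) : M6 k := blk ![![g, 0, 0], ![0, h, 0], ![0, 0, m]]

/-- The block upper unitriangular matrix `[[I,X,Z],[0,I,Y],[0,0,I]]`. -/
def Umat (X Y Z : M2 k) : M6 k := blk ![![1, X, Z], ![0, 1, Y], ![0, 0, 1]]

/-- The 6×6 matrix `J3` with 2×2 blocks `[[0,0,J],[0,J,0],[J,0,0]]`. -/
def J3 : M6 k := blk ![![0, 0, Jmat], ![0, Jmat, 0], ![Jmat, 0, 0]]

/-- The group of symplectic similitudes `GSp6(k)`, as a subset of the 6×6 matrices. -/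
def GSp6 (k : Type*) [Field k] : Set (M6 k) :=
  {g | IsUnit g ∧ ∃ l : kˣ, g * J3 * gᵀ = (l : k) • (J3 : M6 k)}

/-- The Levi subgroup `L3 = { blockdiag(g, h, det(g⁻¹h)·g) }`. -/
def L3 (k : Type*) [Field k] : Set (M6 k) :=
  {m | ∃ g h : M2 k, IsUnit g ∧ IsUnit h ∧ m = bdiag g h ((g⁻¹ * h).det • g)}

/-- The unipotent radical `U3`. -/
def U3 (k : Type*) [Field k] : Set (M6 k) :=
  {m | ∃ X Y Z : M2 k, X * Jmat + Jmat * Yᵀ = 0 ∧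
    Z * Jmat + Jmat * Zᵀ = -(X * Jmat * Xᵀ) ∧ m = Umat X Y Z}

/-- The parabolic subgroup `Q3 = L3 · U3`. -/
def Q3 (k : Type*) [Field k] : Set (M6 k) := L3 k * U3 k

/-- The diagonal embedding `Δ(g) = blockdiag(g,g,g)`. -/
def Dmat (g : M2 k) : M6 k := bdiag g g g

/-- The diagonal copy `Δ(GL2)` of `GL2` in `GSp6`. -/
def DeltaGL2 (k : Type*) [Field k] : Set (M6 k) := {m | ∃ g : M2 k, IsUnit g ∧ m = Dmat g}

/-- The embedding `η(g) = blockdiag(I, g, det(g)·I)`. -/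
def etaMat (g : M2 k) : M6 k := bdiag 1 g (g.det • (1 : M2 k))

/-- The copy `η(GL2)` of `GL2` in `GSp6`. -/
def etaGL2 (k : Type*) [Field k] : Set (M6 k) := {m | ∃ g : M2 k, IsUnit g ∧ m = etaMat g}

/-- The Shalika subgroup `S = Δ(GL2) · U3`. -/
def Sgrp (k : Type*) [Field k] : Set (M6 k) := DeltaGL2 k * U3 k

/-- For a subset `H` of the 6×6 matrices, `Hᵀ = { hᵀ : h ∈ H }`. -/
def setT (H : Set (M6 k)) : Set (M6 k) := Matrix.transpose '' H

/-- The Weyl element `a = blockdiag(J, I, J)`. -/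
def amat : M6 k := bdiag Jmat 1 Jmat

/-- The Weyl element `c = blockdiag(I, J, I)`. -/
def cmat : M6 k := bdiag 1 Jmat 1

/-- The Weyl element `b`. -/
def bmat : M6 k :=
  !![1,0,0,0,0,0; 0,0,1,0,0,0; 0,-1,0,0,0,0; 0,0,0,0,1,0; 0,0,0,-1,0,0; 0,0,0,0,0,1]

/-- The set `Σ = {1, b, b·c·b, b·a·c·b, b·c·a·b·a·c·b}` of double coset representatives. -/
def SigmaSet (k : Type*) [Field k] : Set (M6 k) :=
  {1, bmat, bmat * cmat * bmat, bmat * amat * cmat * bmat,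
    bmat * cmat * amat * bmat * amat * cmat * bmat}

lemma blk_mul (M N : Fin 3 → Fin 3 → M2 k) :
    blk M * blk N = blk (fun i j => M i 0 * N 0 j + M i 1 * N 1 j + M i 2 * N 2 j) := by
  ext i j
  rw [Matrix.mul_apply, Fin.sum_univ_six]
  have h0 : (i.val / 2) < 3 := by omega
  have h1 : (j.val / 2) < 3 := by omega
  have h2 : (i.val % 2) < 2 := by omega
  have h3 : (j.val % 2) < 2 := by omega
  have hr : blk (fun i j => M i 0 * N 0 j + M i 1 * N 1 j + M i 2 * N 2 j) i j =
      (M ⟨_, h0⟩ 0 * N 0 ⟨_, h1⟩) ⟨_, h2⟩ ⟨_, h3⟩ + (M ⟨_, h0⟩ 1 * N 1 ⟨_, h1⟩) ⟨_, h2⟩ ⟨_, h3⟩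
      + (M ⟨_, h0⟩ 2 * N 2 ⟨_, h1⟩) ⟨_, h2⟩ ⟨_, h3⟩ := rfl
  rw [hr, Matrix.mul_apply, Matrix.mul_apply, Matrix.mul_apply, Fin.sum_univ_two,
    Fin.sum_univ_two, Fin.sum_univ_two, ← add_assoc, ← add_assoc]
  rfl

lemma blk_transpose (M : Fin 3 → Fin 3 → M2 k) :
    (blk M)ᵀ = blk (fun i j => (M j i)ᵀ) := by
  ext i j
  rfl

lemma blk_smul (l : k) (M : Fin 3 → Fin 3 → M2 k) :
    l • (blk M) = blk (fun i j => l • (M i j)) := by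
  ext i j
  rfl

lemma blk_one : (1 : M6 k) = blk ![![1, 0, 0], ![0, 1, 0], ![0, 0, 1]] := by
  ext i j
  fin_cases i <;> fin_cases j <;> rfl

lemma blk_inj {M N : Fin 3 → Fin 3 → M2 k} (h : blk M = blk N) : M = N := by
  funext i j
  ext a b
  have h' := congr_fun (congr_fun h ⟨2 * i.val + a.val, by omega⟩) ⟨2 * j.val + b.val, by omega⟩
  fin_cases i <;> fin_cases j <;> fin_cases a <;> fin_cases b <;> exact h'

lemma blk_surj (g : M6 k) : ∃ M, g = blk M := by
  refine ⟨fun i j => Matrix.of fun a b =>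
    g ⟨2 * i.val + a.val, by omega⟩ ⟨2 * j.val + b.val, by omega⟩, ?_⟩
  ext i j
  fin_cases i <;> fin_cases j <;> rfl

lemma blk_congr {M N : Fin 3 → Fin 3 → M2 k} (h : ∀ i j, M i j = N i j) : blk M = blk N := by
  congr 1
  funext i j
  exact h i j

lemma JJ : (Jmat : M2 k) * Jmat = -1 := by
  ext i j
  fin_cases i <;> fin_cases j <;> simp [Jmat]

lemma MJM (A : M2 k) : A * Jmat * Aᵀ = A.det • Jmat := by
  ext i j
  fin_cases i <;> fin_cases j <;>
    simp [Jmat, Matrix.mul_apply, Fin.sum_univ_succ, Matrix.det_fin_two] <;> ring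

lemma J3J3 : (J3 : M6 k) * J3 = -1 := by
  rw [J3, blk_mul]
  have : (-1 : M6 k) = (-1 : k) • 1 := by simp
  rw [this, blk_one, blk_smul]
  apply blk_congr
  intro i j
  fin_cases i <;> fin_cases j <;> simp [JJ]

lemma J3T : (J3 : M6 k)ᵀ = -J3 := by
  have : (-J3 : M6 k) = (-1 : k) • J3 := by simp
  rw [this, J3, blk_transpose, blk_smul]
  apply blk_congr
  intro i j
  have : (Jmat : M2 k)ᵀ = -Jmat := by
    ext i j
    fin_cases i <;> fin_cases j <;> simp [Jmat]
  fin_cases i <;> fin_cases j <;> simp [this]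

/-- The similitude relation already forces invertibility. -/
lemma gsp_of_rel {g : M6 k} {l : k} (hl : l ≠ 0) (h : g * J3 * gᵀ = l • (J3 : M6 k)) :
    g ∈ GSp6 k := by
  refine ⟨?_, Units.mk0 l hl, h⟩
  have : g * (-l⁻¹ • (J3 * gᵀ * J3)) = 1 := by
    rw [Matrix.mul_smul, ← Matrix.mul_assoc, ← Matrix.mul_assoc, h, Matrix.smul_mul, J3J3]
    simp [smul_smul, hl]
  exact IsUnit.of_mul_eq_one _ this

lemma gsp_mul {g h : M6 k} (hg : g ∈ GSp6 k) (hh : h ∈ GSp6 k) : g * h ∈ GSp6 k := by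
  obtain ⟨_, l, e⟩ := hg
  obtain ⟨_, m, f⟩ := hh
  apply gsp_of_rel (l := (l : k) * m) (by simp)
  calc g * h * J3 * (g * h)ᵀ = g * (h * J3 * hᵀ) * gᵀ := by
        simp only [Matrix.transpose_mul, Matrix.mul_assoc]
    _ = _ := by rw [f, Matrix.mul_smul, Matrix.smul_mul, e, smul_smul, mul_comm]

lemma gsp_det {g : M6 k} (hg : g ∈ GSp6 k) : IsUnit g.det :=
  (Matrix.isUnit_iff_isUnit_det _).1 hg.1

lemma gsp_inv {g : M6 k} (hg : g ∈ GSp6 k) : g⁻¹ ∈ GSp6 k := by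
  have hd := gsp_det hg
  obtain ⟨_, l, e⟩ := hg
  apply gsp_of_rel (l := (l : k)⁻¹) (by simp)
  have hdt : IsUnit (gᵀ).det := by rwa [Matrix.det_transpose]
  have : g⁻¹ * (g * J3 * gᵀ) * (gᵀ)⁻¹ = J3 := by
    rw [Matrix.mul_assoc, Matrix.mul_assoc, Matrix.mul_assoc, Matrix.mul_nonsing_inv _ hdt,
      Matrix.mul_one, ← Matrix.mul_assoc, Matrix.nonsing_inv_mul _ hd, Matrix.one_mul]
  rw [e, Matrix.mul_smul, Matrix.smul_mul] at this
  rw [Matrix.transpose_nonsing_inv, ← this, smul_smul]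
  simp [this]

lemma gsp_transpose {g : M6 k} (hg : g ∈ GSp6 k) : gᵀ ∈ GSp6 k := by
  obtain ⟨_, l, e⟩ := hg
  have h1 : g * (-(l : k)⁻¹ • (J3 * gᵀ * J3)) = 1 := by
    rw [Matrix.mul_smul, ← Matrix.mul_assoc, ← Matrix.mul_assoc, e, Matrix.smul_mul, J3J3]
    simp [smul_smul]
  have h2 := mul_eq_one_comm.1 h1
  apply gsp_of_rel (l := (l : k)) (by simp)
  rw [Matrix.transpose_transpose]
  have h3 : J3 * gᵀ * J3 * g = -(l : k) • (1 : M6 k) := by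
    rw [← h2, Matrix.smul_mul, smul_smul]
    simp
  have h4 : J3 * (J3 * gᵀ * J3 * g) = -(gᵀ * J3 * g) := by
    simp only [← Matrix.mul_assoc, J3J3]
    simp
  rw [h3] at h4
  have := congrArg (fun x => -x) h4
  simp only [neg_neg] at this
  rw [← this]
  simp

lemma gsp_bdiag {t w : M2 k} (ht : t.det ≠ 0) (hw : w.det ≠ 0) :
    bdiag t w ((w.det / t.det) • t) ∈ GSp6 k := by
  apply gsp_of_rel (l := w.det) hw
  rw [bdiag, blk_transpose, J3, blk_mul, blk_mul, blk_smul]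
  apply blk_congr
  intro i j
  have h1 := MJM t
  have h2 := MJM w
  fin_cases i <;> fin_cases j <;> simp [h1, h2, smul_smul, ht]

lemma gsp_umat {X Y Z : M2 k} (h1 : X * Jmat + Jmat * Yᵀ = 0)
    (h2 : Z * Jmat + Jmat * Zᵀ = -(X * Jmat * Xᵀ)) : Umat X Y Z ∈ GSp6 k := by
  apply gsp_of_rel (l := 1) one_ne_zero
  have hJ : (Jmat : M2 k)ᵀ = -Jmat := by
    ext i j
    fin_cases i <;> fin_cases j <;> simp [Jmat]
  have h3 : Jmat * Xᵀ + Y * Jmat = 0 := by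
    have := congrArg Matrix.transpose h1
    simp [hJ] at this
    rw [← neg_eq_zero, neg_add]
    exact this
  rw [Umat, blk_transpose, J3, blk_mul, blk_mul, blk_smul]
  apply blk_congr
  intro i j
  fin_cases i <;> fin_cases j <;> simp [h1, h2, h3]
  · rw [add_right_comm, h2]; simp
  · rw [add_comm, h3]

/-- The block upper triangular part of `GSp6`. -/
def Qs (k : Type*) [Field k] : Set (M6 k) :=
  {q | q ∈ GSp6 k ∧ Matrix.BlockTriangular q (fun i : Fin 6 => i.val / 2)}

lemma qs_mul {p q : M6 k} (hp : p ∈ Qs k) (hq : q ∈ Qs k) : p * q ∈ Qs k :=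
  ⟨gsp_mul hp.1 hq.1, hp.2.mul hq.2⟩

lemma qs_inv {q : M6 k} (hq : q ∈ Qs k) : q⁻¹ ∈ Qs k := by
  refine ⟨gsp_inv hq.1, ?_⟩
  have : Invertible q := hq.1.1.invertible
  exact Matrix.blockTriangular_inv_of_blockTriangular hq.2

lemma blk_tri {M : Fin 3 → Fin 3 → M2 k} (h1 : M 1 0 = 0) (h2 : M 2 0 = 0) (h3 : M 2 1 = 0) :
    Matrix.BlockTriangular (blk M) (fun i : Fin 6 => i.val / 2) := by
  have h : ∀ a b : Fin 3, b < a → M a b = 0 := by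
    intro a b hab
    fin_cases a <;> fin_cases b <;> first | exact absurd hab (by decide) | assumption
  intro i j hij
  have h' := h ⟨i.val / 2, by omega⟩ ⟨j.val / 2, by omega⟩ hij
  exact congr_fun (congr_fun h' _) _

lemma tri_blk {M : Fin 3 → Fin 3 → M2 k}
    (h : Matrix.BlockTriangular (blk M) (fun i : Fin 6 => i.val / 2)) :
    M 1 0 = 0 ∧ M 2 0 = 0 ∧ M 2 1 = 0 := by
  refine ⟨?_, ?_, ?_⟩
  · ext a b
    have := @h ⟨2 + a.val, by omega⟩ ⟨b.val, by omega⟩ (by simp; omega)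
    fin_cases a <;> fin_cases b <;> exact this
  · ext a b
    have := @h ⟨4 + a.val, by omega⟩ ⟨b.val, by omega⟩ (by simp; omega)
    fin_cases a <;> fin_cases b <;> exact this
  · ext a b
    have := @h ⟨4 + a.val, by omega⟩ ⟨2 + b.val, by omega⟩ (by simp; omega)
    fin_cases a <;> fin_cases b <;> exact this

lemma qs_bdiag {t w : M2 k} (ht : t.det ≠ 0) (hw : w.det ≠ 0) :
    bdiag t w ((w.det / t.det) • t) ∈ Qs k :=
  ⟨gsp_bdiag ht hw, blk_tri (by simp) (by simp) (by simp)⟩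

lemma qs_umat {X Y Z : M2 k} (h1 : X * Jmat + Jmat * Yᵀ = 0)
    (h2 : Z * Jmat + Jmat * Zᵀ = -(X * Jmat * Xᵀ)) : Umat X Y Z ∈ Qs k :=
  ⟨gsp_umat h1 h2, blk_tri (by simp) (by simp) (by simp)⟩

lemma qs_eta {v : M2 k} (hv : IsUnit v) : etaMat v ∈ Qs k := by
  have h := ((Matrix.isUnit_iff_isUnit_det _).1 hv).ne_zero
  have := qs_bdiag (t := (1 : M2 k)) (by simp) h
  simpa [etaMat] using this

lemma qs_delta {v : M2 k} (hv : IsUnit v) : Dmat v ∈ Qs k := by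
  have h := ((Matrix.isUnit_iff_isUnit_det _).1 hv).ne_zero
  have := qs_bdiag (t := v) h h
  simpa [Dmat, h] using this

lemma qs_sgrp {s : M6 k} (hs : s ∈ Sgrp k) : s ∈ Qs k := by
  obtain ⟨_, ⟨t, ht, rfl⟩, _, ⟨X, Y, Z, h1, h2, rfl⟩, rfl⟩ := hs
  exact qs_mul (qs_delta ht) (qs_umat h1 h2)

lemma qs_decomp {q : M6 k} (hq : q ∈ Qs k) :
    ∃ v : M2 k, IsUnit v ∧ ∃ s ∈ Sgrp k, q = etaMat v * s := by
  obtain ⟨⟨_, l, e⟩, ht⟩ := hq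
  obtain ⟨M, rfl⟩ := blk_surj q
  obtain ⟨z1, z2, z3⟩ := tri_blk ht
  rw [blk_transpose, J3, blk_mul, blk_mul, blk_smul] at e
  have e' := blk_inj e
  have e00 := congr_fun (congr_fun e' 0) 0
  have e01 := congr_fun (congr_fun e' 0) 1
  have e02 := congr_fun (congr_fun e' 0) 2
  have e11 := congr_fun (congr_fun e' 1) 1
  simp [z1, z2, z3] at e00 e01 e02 e11
  set A := M 0 0 with hA
  set B := M 0 1 with hB
  set C := M 0 2 with hC
  set E := M 1 1 with hE
  set F := M 1 2 with hF
  set K := M 2 2 with hK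
  have hl : (l : k) ≠ 0 := by simp
  have hEd : E.det = l := by
    rw [MJM] at e11
    have := congr_fun (congr_fun e11 1) 0
    simpa [Jmat] using this
  have hAd : A.det ≠ 0 := by
    intro h0
    have := congrArg Matrix.det e02
    simp [Matrix.det_mul, h0, Matrix.det_smul, Jmat] at this
  have uA : IsUnit A.det := hAd.isUnit
  have uE : IsUnit E.det := by rw [hEd]; exact hl.isUnit
  have uAT : IsUnit (Aᵀ).det := by rwa [Matrix.det_transpose]
  have uET : IsUnit (Eᵀ).det := by rwa [Matrix.det_transpose]
  have hJ : IsUnit (Jmat : M2 k).det := by simp [Jmat]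
  have hKT : Kᵀ = (E.det / A.det) • Aᵀ := by
    have h1 : A * Jmat * Kᵀ = A * Jmat * ((E.det / A.det) • Aᵀ) := by
      rw [e02, Matrix.mul_smul, MJM, smul_smul, hEd]
      congr 1
      field_simp
    have h2 : IsUnit (A * Jmat).det := by rw [Matrix.det_mul]; exact uA.mul hJ
    have h3 := congrArg (fun x => (A * Jmat)⁻¹ * x) h1
    simpa only [← Matrix.mul_assoc, Matrix.nonsing_inv_mul _ h2, Matrix.one_mul] using h3
  have hK' : K = (E.det / A.det) • A := by
    have := congrArg Matrix.transpose hKT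
    simpa using this
  have cA : ∀ N : M2 k, A⁻¹ * (A * N) = N := fun N => by
    rw [← Matrix.mul_assoc, Matrix.nonsing_inv_mul _ uA, Matrix.one_mul]
  have cA' : ∀ N : M2 k, A * (A⁻¹ * N) = N := fun N => by
    rw [← Matrix.mul_assoc, Matrix.mul_nonsing_inv _ uA, Matrix.one_mul]
  have cE' : ∀ N : M2 k, E * (E⁻¹ * N) = N := fun N => by
    rw [← Matrix.mul_assoc, Matrix.mul_nonsing_inv _ uE, Matrix.one_mul]
  refine ⟨E * A⁻¹, ?_, Dmat A * Umat (A⁻¹ * B) (E⁻¹ * F) (A⁻¹ * C), ?_, ?_⟩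
  · rw [Matrix.isUnit_iff_isUnit_det, Matrix.det_mul]
    exact uE.mul (Matrix.isUnit_nonsing_inv_det _ uA)
  · refine Set.mul_mem_mul ⟨A, (Matrix.isUnit_iff_isUnit_det _).2 uA, rfl⟩
      ⟨_, _, _, ?_, ?_, rfl⟩
    · have : A⁻¹ * (A * Jmat * Fᵀ + B * Jmat * Eᵀ) * (Eᵀ)⁻¹ = 0 := by
        rw [add_comm] at e01
        rw [e01]; simp
      rw [Matrix.mul_add, Matrix.add_mul] at this
      simp only [Matrix.mul_assoc, cA, Matrix.mul_nonsing_inv _ uET, Matrix.mul_one] at this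
      rw [Matrix.transpose_mul, Matrix.transpose_nonsing_inv, add_comm, Matrix.mul_assoc]
      exact this
    · have h5 : C * Jmat * Aᵀ + A * Jmat * Cᵀ = -(B * Jmat * Bᵀ) := by
        rw [eq_neg_iff_add_eq_zero, ← e00]
        abel
      have h6 := congrArg (fun x => A⁻¹ * x * (Aᵀ)⁻¹) h5
      simp only [Matrix.mul_add, Matrix.add_mul, Matrix.mul_assoc, cA,
        Matrix.mul_nonsing_inv _ uAT, Matrix.mul_one, Matrix.mul_neg, Matrix.neg_mul] at h6
      simp only [Matrix.transpose_mul, Matrix.transpose_nonsing_inv, Matrix.mul_assoc]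
      exact h6
  · rw [etaMat, Dmat, Umat, bdiag, bdiag, blk_mul, blk_mul]
    apply blk_congr
    intro i j
    fin_cases i <;> fin_cases j <;>
      simp [z1, z2, z3, cA', ← hA, ← hB, ← hC, ← hE, ← hF, ← hK, Matrix.mul_assoc,
        Matrix.nonsing_inv_mul _ uA, cE', cA]
    rw [hK', div_eq_mul_inv]

/-- A `2 × 6` matrix given by three `2 × 2` blocks. -/
def rb (A B C : M2 k) : Matrix (Fin 2) (Fin 6) k :=
  Matrix.of fun i j => (![A, B, C] : Fin 3 → M2 k) ⟨j.val / 2, by omega⟩ i ⟨j.val % 2, by omega⟩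

lemma rb_surj (T : Matrix (Fin 2) (Fin 6) k) : ∃ A B C, T = rb A B C := by
  refine ⟨Matrix.of fun a b => T a ⟨b.val, by omega⟩, Matrix.of fun a b => T a ⟨2 + b.val, by omega⟩,
    Matrix.of fun a b => T a ⟨4 + b.val, by omega⟩, ?_⟩
  ext i j
  fin_cases j <;> rfl

lemma rb_inj {A B C A' B' C' : M2 k} (h : rb A B C = rb A' B' C') : A = A' ∧ B = B' ∧ C = C' := by
  refine ⟨?_, ?_, ?_⟩
  · ext a b
    have h' := congr_fun (congr_fun h a) ⟨b.val, by omega⟩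
    fin_cases b <;> exact h'
  · ext a b
    have h' := congr_fun (congr_fun h a) ⟨2 + b.val, by omega⟩
    fin_cases b <;> exact h'
  · ext a b
    have h' := congr_fun (congr_fun h a) ⟨4 + b.val, by omega⟩
    fin_cases b <;> exact h'

lemma rb_zero : rb (0 : M2 k) 0 0 = 0 := by
  ext i j
  fin_cases j <;> rfl

lemma mul_rb (P A B C : M2 k) : P * rb A B C = rb (P * A) (P * B) (P * C) := by
  ext i j
  fin_cases j <;> rfl

lemma vec_rb (v : Fin 2 → k) {A B C : M2 k} (hA : v ᵥ* A = 0) (hB : v ᵥ* B = 0)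
    (hC : v ᵥ* C = 0) : v ᵥ* rb A B C = 0 := by
  ext j
  fin_cases j
  · exact congr_fun hA 0
  · exact congr_fun hA 1
  · exact congr_fun hB 0
  · exact congr_fun hB 1
  · exact congr_fun hC 0
  · exact congr_fun hC 1

lemma vec_rb' (v : Fin 2 → k) {A B C : M2 k} (h : v ᵥ* rb A B C = 0) :
    v ᵥ* A = 0 ∧ v ᵥ* B = 0 ∧ v ᵥ* C = 0 := by
  refine ⟨?_, ?_, ?_⟩
  · ext b
    have h' := congr_fun h ⟨b.val, by omega⟩
    fin_cases b <;> exact h'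
  · ext b
    have h' := congr_fun h ⟨2 + b.val, by omega⟩
    fin_cases b <;> exact h'
  · ext b
    have h' := congr_fun h ⟨4 + b.val, by omega⟩
    fin_cases b <;> exact h'

lemma rb_mul_blk (A B C : M2 k) (M : Fin 3 → Fin 3 → M2 k) :
    rb A B C * blk M = rb (A * M 0 0 + B * M 1 0 + C * M 2 0)
      (A * M 0 1 + B * M 1 1 + C * M 2 1) (A * M 0 2 + B * M 1 2 + C * M 2 2) := by
  have key : ∀ l : Fin 3, ∀ i : Fin 2, ∀ b : Fin 2,
      (A * M 0 l + B * M 1 l + C * M 2 l) i b =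
      A i 0 * M 0 l 0 b + A i 1 * M 0 l 1 b + B i 0 * M 1 l 0 b + B i 1 * M 1 l 1 b
        + C i 0 * M 2 l 0 b + C i 1 * M 2 l 1 b := by
    intro l i b
    rw [Matrix.add_apply, Matrix.add_apply, Matrix.mul_apply, Matrix.mul_apply, Matrix.mul_apply,
      Fin.sum_univ_two, Fin.sum_univ_two, Fin.sum_univ_two]
    ring
  ext i j
  rw [Matrix.mul_apply, Fin.sum_univ_six]
  fin_cases j
  · exact (key 0 i 0).symm
  · exact (key 0 i 1).symm
  · exact (key 1 i 0).symm
  · exact (key 1 i 1).symm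
  · exact (key 2 i 0).symm
  · exact (key 2 i 1).symm

lemma rb_mul_rbT (A B C A' B' C' : M2 k) :
    rb A B C * (rb A' B' C')ᵀ = A * A'ᵀ + B * B'ᵀ + C * C'ᵀ := by
  ext i j
  rw [Matrix.mul_apply, Fin.sum_univ_six, Matrix.add_apply, Matrix.add_apply, Matrix.mul_apply,
    Matrix.mul_apply, Matrix.mul_apply, Fin.sum_univ_two, Fin.sum_univ_two, Fin.sum_univ_two,
    ← add_assoc, ← add_assoc]
  rfl

lemma rb_iso (A B C : M2 k) :
    rb A B C * (J3 : M6 k) * (rb A B C)ᵀ = C * Jmat * Aᵀ + B * Jmat * Bᵀ + A * Jmat * Cᵀ := by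
  rw [J3, rb_mul_blk, rb_mul_rbT]
  simp

/-- The projection to the first block row. -/
def S0 (k : Type*) [Field k] : Matrix (Fin 2) (Fin 6) k := rb 1 0 0

lemma S0_blk (M : Fin 3 → Fin 3 → M2 k) : S0 k * blk M = rb (M 0 0) (M 0 1) (M 0 2) := by
  rw [S0, rb_mul_blk]
  simp

/-- Equivalence of `2 × 6` matrices under `GL2` on the left and `Q` on the right. -/
def TRel (T T' : Matrix (Fin 2) (Fin 6) k) : Prop :=
  ∃ P : M2 k, IsUnit P.det ∧ ∃ q ∈ Qs k, T' = P * T * q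

lemma TRel.symm {T T' : Matrix (Fin 2) (Fin 6) k} (h : TRel T T') : TRel T' T := by
  obtain ⟨P, hP, q, hq, rfl⟩ := h
  refine ⟨P⁻¹, Matrix.isUnit_nonsing_inv_det _ hP, q⁻¹, qs_inv hq, ?_⟩
  rw [Matrix.mul_assoc, Matrix.mul_assoc, Matrix.mul_nonsing_inv _ (gsp_det hq.1), Matrix.mul_one,
    ← Matrix.mul_assoc, Matrix.nonsing_inv_mul _ hP, Matrix.one_mul]

lemma TRel.trans {T T' T'' : Matrix (Fin 2) (Fin 6) k} (h : TRel T T') (h' : TRel T' T'') :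
    TRel T T'' := by
  obtain ⟨P, hP, q, hq, rfl⟩ := h
  obtain ⟨P', hP', q', hq', rfl⟩ := h'
  refine ⟨P' * P, ?_, q * q', qs_mul hq hq', ?_⟩
  · rw [Matrix.det_mul]; exact hP'.mul hP
  · simp only [Matrix.mul_assoc]

/-- Isotropic of full rank. -/
def Good (T : Matrix (Fin 2) (Fin 6) k) : Prop :=
  T * (J3 : M6 k) * Tᵀ = 0 ∧ ∀ v : Fin 2 → k, v ᵥ* T = 0 → v = 0

lemma vec_cancel {n : Type*} [Fintype n] [DecidableEq n] {P : Matrix n n k} (hP : IsUnit P.det)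
    {v : n → k} (h : v ᵥ* P = 0) : v = 0 := by
  have := congrArg (fun x => x ᵥ* P⁻¹) h
  simpa [Matrix.vecMul_vecMul, Matrix.mul_nonsing_inv _ hP] using this

lemma Good.rel {T T' : Matrix (Fin 2) (Fin 6) k} (hT : Good T) (h : TRel T T') : Good T' := by
  obtain ⟨P, hP, q, hq, rfl⟩ := h
  refine ⟨?_, ?_⟩
  · obtain ⟨⟨_, l, e⟩, _⟩ := hq
    calc P * T * q * (J3 : M6 k) * (P * T * q)ᵀ = P * T * (q * (J3 : M6 k) * qᵀ) * (Tᵀ * Pᵀ) := by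
          simp only [Matrix.transpose_mul, Matrix.mul_assoc]
      _ = (l : k) • (P * (T * (J3 : M6 k) * Tᵀ) * Pᵀ) := by
          rw [e, Matrix.mul_smul, Matrix.smul_mul]
          simp only [Matrix.mul_assoc]
      _ = 0 := by rw [hT.1]; simp
  · intro v hv
    rw [Matrix.mul_assoc, ← Matrix.vecMul_vecMul, ← Matrix.vecMul_vecMul] at hv
    exact vec_cancel hP (hT.2 _ (vec_cancel (gsp_det hq.1) hv))

lemma good_S0 {g : M6 k} (hg : g ∈ GSp6 k) : Good (S0 k * g) := by
  refine ⟨?_, ?_⟩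
  · obtain ⟨_, l, e⟩ := hg
    calc S0 k * g * (J3 : M6 k) * (S0 k * g)ᵀ = S0 k * (g * (J3 : M6 k) * gᵀ) * (S0 k)ᵀ := by
          simp only [Matrix.transpose_mul, Matrix.mul_assoc]
      _ = (l : k) • (S0 k * (J3 : M6 k) * (S0 k)ᵀ) := by rw [e, Matrix.mul_smul, Matrix.smul_mul]
      _ = 0 := by rw [S0, rb_iso]; simp
  · intro v hv
    rw [← Matrix.vecMul_vecMul] at hv
    have := vec_rb' v (vec_cancel (gsp_det hg) hv)
    simpa using this.1

lemma isUnit_fin_two {a b c d : k} (h : a * d - b * c ≠ 0) :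
    IsUnit (!![a, b; c, d] : M2 k).det := by
  rw [Matrix.det_fin_two_of]
  exact h.isUnit

lemma qs_one : (1 : M6 k) ∈ Qs k :=
  ⟨gsp_of_rel (l := 1) one_ne_zero (by simp), Matrix.blockTriangular_one⟩

/-- Parametrised unipotent elements. -/
lemma qs_U (x1 x2 x3 x4 z1 z2 z3 : k) :
    Umat !![x1, x2; x3, x4] !![-x4, x2; x3, -x1]
      !![z1, z2; z3, -z1 - (x1 * x4 - x2 * x3)] ∈ Qs k := by
  apply qs_umat
  · ext i j
    fin_cases i <;> fin_cases j <;> simp [Jmat, Matrix.mul_apply, Fin.sum_univ_two, Matrix.vecMul, dotProduct]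
  · ext i j
    fin_cases i <;> fin_cases j <;> simp [Jmat, Matrix.mul_apply, Fin.sum_univ_two, Matrix.vecMul, dotProduct] <;> ring

lemma rb_mul_U (A B C X Y Z : M2 k) :
    rb A B C * Umat X Y Z = rb A (A * X + B) (A * Z + B * Y + C) := by
  rw [Umat, rb_mul_blk]
  simp

lemma rb_mul_bdiag (A B C X Y Z : M2 k) :
    rb A B C * bdiag X Y Z = rb (A * X) (B * Y) (C * Z) := by
  rw [bdiag, rb_mul_blk]
  simp

lemma bmat_blk : (bmat : M6 k) = blk ![![!![1, 0; 0, 0], !![0, 0; 1, 0], 0],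
    ![!![0, -1; 0, 0], 0, !![0, 0; 1, 0]], ![0, !![0, -1; 0, 0], !![0, 0; 0, 1]]] := by
  ext i j
  fin_cases i <;> fin_cases j <;> rfl

lemma rb_b (A B C : M2 k) : rb A B C * (bmat : M6 k) = rb
    (A * !![1, 0; 0, 0] + B * !![0, -1; 0, 0]) (A * !![0, 0; 1, 0] + C * !![0, -1; 0, 0])
    (B * !![0, 0; 1, 0] + C * !![0, 0; 0, 1]) := by
  rw [bmat_blk, rb_mul_blk]
  simp

lemma S1 : S0 k * (1 : M6 k) = rb 1 0 0 := by rw [Matrix.mul_one, S0]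

lemma S2 : S0 k * (bmat : M6 k) = rb !![1, 0; 0, 0] !![0, 0; 1, 0] 0 := by
  rw [S0, rb_b]
  simp

lemma S3 : S0 k * ((bmat : M6 k) * cmat * bmat) =
    rb !![1, 0; 0, 0] 0 !![0, 0; -1, 0] := by
  rw [← Matrix.mul_assoc, ← Matrix.mul_assoc, S2, cmat, rb_mul_bdiag, rb_b]
  congr 1 <;> ext i j <;> fin_cases i <;> fin_cases j <;>
    simp [Jmat, Matrix.mul_apply, Fin.sum_univ_two, Matrix.vecMul, dotProduct]

lemma S4 : S0 k * ((bmat : M6 k) * amat * cmat * bmat) =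
    rb 0 !![-1, 0; 0, 0] !![0, 0; -1, 0] := by
  rw [← Matrix.mul_assoc, ← Matrix.mul_assoc, ← Matrix.mul_assoc, S2, amat, rb_mul_bdiag, cmat,
    rb_mul_bdiag, rb_b]
  congr 1 <;> ext i j <;> fin_cases i <;> fin_cases j <;>
    simp [Jmat, Matrix.mul_apply, Fin.sum_univ_two, Matrix.vecMul, dotProduct]

lemma S5 : S0 k * ((bmat : M6 k) * cmat * amat * bmat * amat * cmat * bmat) =
    rb 0 0 !![1, 0; 0, 1] := by
  have h : S0 k * (bmat : M6 k) * (cmat : M6 k) * (amat : M6 k) * (bmat : M6 k) =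
      rb 0 !![-1, 0; 0, 0] !![0, 0; -1, 0] := by
    rw [S2, cmat, rb_mul_bdiag, amat, rb_mul_bdiag, rb_b]
    congr 1 <;> ext i j <;> fin_cases i <;> fin_cases j <;>
      simp [Jmat, Matrix.mul_apply, Fin.sum_univ_two, Matrix.vecMul, dotProduct]
  simp only [← Matrix.mul_assoc]
  rw [h, amat, rb_mul_bdiag, cmat, rb_mul_bdiag, rb_b]
  congr 1 <;> ext i j <;> fin_cases i <;> fin_cases j <;>
    simp [Jmat, Matrix.mul_apply, Fin.sum_univ_two, Matrix.vecMul, dotProduct]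

/-- The claim that `T` is equivalent to one of the five representatives. -/
def Reaches (T : Matrix (Fin 2) (Fin 6) k) : Prop :=
  ∃ σ ∈ SigmaSet k, TRel (S0 k * σ) T

lemma Reaches.of_rel {T T' : Matrix (Fin 2) (Fin 6) k} (h : TRel T T') (h' : Reaches T') :
    Reaches T := by
  obtain ⟨σ, hσ, r⟩ := h'
  exact ⟨σ, hσ, r.trans h.symm⟩

/-- Moving by `GL2` on the left and by the Levi subgroup on the right. -/
lemma rel_levi {P t w : M2 k} (hP : P.det ≠ 0) (ht : t.det ≠ 0) (hw : w.det ≠ 0) (A B C : M2 k) :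
    TRel (rb A B C)
      (rb (P * A * t) (P * B * w) (P * C * ((w.det / t.det) • t))) :=
  ⟨P, hP.isUnit, _, qs_bdiag ht hw, by rw [mul_rb, rb_mul_bdiag]⟩

lemma eta2 (A : M2 k) : A = !![A 0 0, A 0 1; A 1 0, A 1 1] := Matrix.eta_fin_two A

lemma vec_norm (x y : k) (h : ¬(x = 0 ∧ y = 0)) :
    ∃ t1 t2 t3 t4 : k, t1 * t4 - t2 * t3 ≠ 0 ∧ x * t1 + y * t3 = 1 ∧ x * t2 + y * t4 = 0 := by
  by_cases hx : x = 0
  · have hy : y ≠ 0 := fun hy => h ⟨hx, hy⟩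
    refine ⟨0, 1, y⁻¹, 0, ?_, ?_, ?_⟩
    · simp [hy]
    · simp [hy]
    · simp [hx]
  · refine ⟨x⁻¹, -y, 0, x, ?_, ?_, ?_⟩
    · simp [hx]
    · simp [hx]
    · ring

/-- Normal form of a rank one `2 × 2` matrix. -/
lemma rank_one_norm (A : M2 k) (hA : A ≠ 0) (hd : A.det = 0) :
    ∃ P t : M2 k, P.det ≠ 0 ∧ t.det ≠ 0 ∧ P * A * t = !![1, 0; 0, 0] := by
  have key : ∀ a b c d : k, ¬(a = 0 ∧ b = 0) → a * d - b * c = 0 →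
      ∃ P t : M2 k, P.det ≠ 0 ∧ t.det ≠ 0 ∧ P * !![a, b; c, d] * t = !![1, 0; 0, 0] := by
    intro a b c d h h0
    obtain ⟨t1, t2, t3, t4, ht, h1, h2⟩ := vec_norm a b h
    refine ⟨!![1, 0; -(c * t1 + d * t3), 1], !![t1, t2; t3, t4], ?_, ?_, ?_⟩
    · simp
    · simpa using ht
    · have h3 : c * t2 + d * t4 = 0 := by
        have e : (c * t2 + d * t4) * (a * t1 + b * t3) =
          (c * t1 + d * t3) * (a * t2 + b * t4) + (a * d - b * c) * (t1 * t4 - t2 * t3) := by ring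
        rw [h1, h2, h0] at e
        simpa using e
      rw [Matrix.mul_assoc, Matrix.mul_fin_two, Matrix.mul_fin_two, h1, h2, h3]
      simp
  have e := eta2 A
  rw [Matrix.det_fin_two] at hd
  by_cases h : A 0 0 = 0 ∧ A 0 1 = 0
  · have h' : ¬(A 1 0 = 0 ∧ A 1 1 = 0) := by
      rintro ⟨h3, h4⟩
      apply hA
      rw [e, h.1, h.2, h3, h4]
      ext i j
      fin_cases i <;> fin_cases j <;> rfl
    obtain ⟨P, t, hP, ht, hh⟩ := key (A 1 0) (A 1 1) (A 0 0) (A 0 1) h' (by linear_combination -hd)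
    refine ⟨P * !![0, 1; 1, 0], t, ?_, ht, ?_⟩
    · rw [Matrix.det_mul]
      simpa using hP
    · rw [← hh, Matrix.mul_assoc P]
      congr 2
      conv_lhs => rw [e]
      rw [Matrix.mul_fin_two]
      simp
  · obtain ⟨P, t, hP, ht, hh⟩ := key _ _ _ _ h hd
    rw [← e] at hh
    exact ⟨P, t, hP, ht, hh⟩

/-- The scalar form of isotropy. -/
lemma iso_scalar {a1 a2 a3 a4 b1 b2 b3 b4 c1 c2 c3 c4 : k}
    (h : Good (rb !![a1, a2; a3, a4] !![b1, b2; b3, b4] !![c1, c2; c3, c4])) :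
    c2 * a3 - c1 * a4 + (b2 * b3 - b1 * b4) + (a2 * c3 - a1 * c4) = 0 := by
  have h1 := h.1
  rw [rb_iso] at h1
  have h2 := congr_fun (congr_fun h1 0) 1
  simp [Jmat, Matrix.mul_apply, Fin.sum_univ_two, Matrix.vecMul, dotProduct] at h2
  linear_combination h2

lemma sig1 : (1 : M6 k) ∈ SigmaSet k := by simp [SigmaSet]
lemma sig2 : (bmat : M6 k) ∈ SigmaSet k := by simp [SigmaSet]
lemma sig3 : (bmat * cmat * bmat : M6 k) ∈ SigmaSet k := by simp [SigmaSet]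
lemma sig4 : (bmat * amat * cmat * bmat : M6 k) ∈ SigmaSet k := by simp [SigmaSet]
lemma sig5 : (bmat * cmat * amat * bmat * amat * cmat * bmat : M6 k) ∈ SigmaSet k := by
  simp [SigmaSet]

lemma reach1 {A B C : M2 k} (hA : A.det ≠ 0) (hg : Good (rb A B C)) : Reaches (rb A B C) := by
  have uA := hA.isUnit
  have r : TRel (rb A B C) (rb 1 (A⁻¹ * B) (A⁻¹ * C)) :=
    ⟨A⁻¹, Matrix.isUnit_nonsing_inv_det _ uA, 1, qs_one, by
      rw [Matrix.mul_one, mul_rb, Matrix.nonsing_inv_mul _ uA]⟩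
  refine Reaches.of_rel r ?_
  have hg' := hg.rel r
  generalize A⁻¹ * B = X at *
  generalize A⁻¹ * C = Z at *
  refine ⟨1, sig1, 1, by simp, _, qs_U (X 0 0) (X 0 1) (X 1 0) (X 1 1) (Z 0 0) (Z 0 1) (Z 1 0), ?_⟩
  rw [S1, Matrix.one_mul, rb_mul_U]
  rw [eta2 X, eta2 Z, Matrix.one_fin_two] at hg'
  have := iso_scalar hg'
  have e : -Z 0 0 - (X 0 0 * X 1 1 - X 0 1 * X 1 0) = Z 1 1 := by linear_combination this
  rw [e, ← eta2 X, ← eta2 Z]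
  simp

lemma reach2 {b1 b2 c1 c2 c3 c4 : k}
    (hg : Good (rb !![1, 0; 0, 0] !![b1, b2; 1, 0] !![c1, c2; c3, c4])) :
    Reaches (rb !![1, 0; 0, 0] !![b1, b2; 1, 0] !![c1, c2; c3, c4]) := by
  have h := iso_scalar hg
  have h4 : b2 = c4 := by linear_combination h
  subst h4
  refine ⟨_, sig2, !![1, b1; 0, 1], by simp, _,
    qs_U 0 b2 0 (-c3) (c1 - b1 * c3) (c2 - b1 * b2) 0, ?_⟩
  rw [S2, mul_rb, rb_mul_U]
  congr 1 <;> ext i j <;> fin_cases i <;> fin_cases j <;>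
    simp [Matrix.mul_apply, Fin.sum_univ_two]

lemma reach3 {b1 b2 c1 c2 c3 c4 : k}
    (hg : Good (rb !![1, 0; 0, 0] !![b1, b2; 0, 0] !![c1, c2; c3, c4])) :
    Reaches (rb !![1, 0; 0, 0] !![b1, b2; 0, 0] !![c1, c2; c3, c4]) := by
  have h := iso_scalar hg
  have h4 : c4 = 0 := by linear_combination -h
  subst h4
  have h3 : c3 ≠ 0 := by
    rintro rfl
    have := hg.2 ![0, 1] (vec_rb _ (by ext j; fin_cases j <;> simp [Matrix.vecMul, dotProduct])
      (by ext j; fin_cases j <;> simp [Matrix.vecMul, dotProduct])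
      (by ext j; fin_cases j <;> simp [Matrix.vecMul, dotProduct]))
    simpa using congr_fun this 1
  refine ⟨_, sig3, !![1, 0; 0, -c3], by simpa using h3, _, qs_U b1 b2 0 0 c1 c2 0, ?_⟩
  rw [S3, mul_rb, rb_mul_U]
  congr 1 <;> ext i j <;> fin_cases i <;> fin_cases j <;>
    simp [Matrix.mul_apply, Fin.sum_univ_two]

lemma reach4 {c1 c2 d : k} (hd : d ≠ 0) :
    Reaches (rb 0 !![1, 0; 0, 0] !![c1, c2; d, 0]) := by
  refine ⟨_, sig4, !![-1, 0; 0, -d], by simpa using hd, _, qs_U 0 c2 0 (-c1) 0 0 0, ?_⟩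
  rw [S4, mul_rb, rb_mul_U]
  congr 1 <;> ext i j <;> fin_cases i <;> fin_cases j <;>
    simp [Matrix.mul_apply, Fin.sum_univ_two]

lemma reach5 {C : M2 k} (hg : Good (rb 0 0 C)) : Reaches (rb 0 0 C) := by
  have hC : C.det ≠ 0 := by
    intro h0
    obtain ⟨v, hv, hv'⟩ := Matrix.exists_vecMul_eq_zero_iff.2 h0
    exact hv (hg.2 v (vec_rb v (by simp) (by simp) hv'))
  refine ⟨_, sig5, C, hC.isUnit, 1, qs_one, ?_⟩
  rw [S5, mul_rb, Matrix.mul_one, ← Matrix.one_fin_two]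
  simp

lemma reaches_all (T : Matrix (Fin 2) (Fin 6) k) (hg : Good T) : Reaches T := by
  obtain ⟨A, B, C, rfl⟩ := rb_surj T
  by_cases hA : A.det = 0
  swap
  · exact reach1 hA hg
  have d1 : (1 : M2 k).det ≠ 0 := by simp
  by_cases hA0 : A = 0
  · subst hA0
    by_cases hB0 : B = 0
    · subst hB0
      exact reach5 hg
    have hB : B.det = 0 := by
      have h0 : (0 : M2 k) = !![0, 0; 0, 0] := by
        ext i j; fin_cases i <;> fin_cases j <;> rfl
      have hg' := hg
      rw [eta2 B, eta2 C, h0] at hg'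
      have := iso_scalar hg'
      rw [Matrix.det_fin_two]
      linear_combination -this
    obtain ⟨P, w, hP, hw, e⟩ := rank_one_norm B hB0 hB
    have r := rel_levi hP d1 hw 0 B C
    refine Reaches.of_rel r ?_
    have hg' := hg.rel r
    rw [e] at hg' ⊢
    simp only [Matrix.mul_zero, Matrix.zero_mul] at hg' ⊢
    generalize P * C * ((w.det / (1 : M2 k).det) • 1) = D at *
    have hD : ¬(D 1 0 = 0 ∧ D 1 1 = 0) := by
      rintro ⟨h1, h2⟩
      have := hg'.2 ![0, 1] (vec_rb _ (by simp)
        (by ext j; fin_cases j <;> simp [Matrix.vecMul, dotProduct])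
        (by ext j; fin_cases j <;> simp [Matrix.vecMul, dotProduct, h1, h2]))
      simpa using congr_fun this 1
    obtain ⟨t1, t2, t3, t4, ht, h1, h2⟩ := vec_norm _ _ hD
    have ht' : (!![t1, t2; t3, t4] : M2 k).det ≠ 0 := by simpa using ht
    have r2 := rel_levi d1 ht' d1 0 !![1, 0; 0, 0] D
    refine Reaches.of_rel r2 ?_
    generalize hs : (1 : M2 k).det / (!![t1, t2; t3, t4] : M2 k).det = s
    have hs0 : s ≠ 0 := by
      rw [← hs]
      exact div_ne_zero d1 ht'
    have e2 : (1 : M2 k) * D * (s • !![t1, t2; t3, t4]) =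
        !![s * (D 0 0 * t1 + D 0 1 * t3), s * (D 0 0 * t2 + D 0 1 * t4); s, 0] := by
      conv_lhs => rw [Matrix.one_mul, Matrix.mul_smul, eta2 D, Matrix.mul_fin_two, h1, h2]
      simp
    rw [e2]
    simp only [Matrix.mul_zero, Matrix.zero_mul, Matrix.one_mul, Matrix.mul_one]
    exact reach4 hs0
  · obtain ⟨P, t, hP, ht, e⟩ := rank_one_norm A hA0 hA
    have r := rel_levi hP ht d1 A B C
    refine Reaches.of_rel r ?_
    have hg' := hg.rel r
    rw [e] at hg' ⊢
    generalize P * C * _ = D at *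
    generalize P * B * 1 = F at *
    by_cases hF : F 1 0 = 0 ∧ F 1 1 = 0
    · rw [eta2 F, hF.1, hF.2, eta2 D] at hg' ⊢
      exact reach3 hg'
    · obtain ⟨t1, t2, t3, t4, ht, h1, h2⟩ := vec_norm _ _ hF
      have ht' : (!![t1, t2; t3, t4] : M2 k).det ≠ 0 := by simpa using ht
      have r2 := rel_levi d1 d1 ht' !![1, 0; 0, 0] F D
      refine Reaches.of_rel r2 ?_
      have hg2 := hg'.rel r2
      have e2 : (1 : M2 k) * F * !![t1, t2; t3, t4] =
          !![F 0 0 * t1 + F 0 1 * t3, F 0 0 * t2 + F 0 1 * t4; 1, 0] := by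
        conv_lhs => rw [Matrix.one_mul, eta2 F, Matrix.mul_fin_two, h1, h2]
      rw [e2, Matrix.mul_one, Matrix.one_mul] at hg2 ⊢
      generalize (1 : M2 k) * D * _ = G at *
      rw [eta2 G] at hg2 ⊢
      exact reach2 hg2

lemma qsT_S0 {p : M6 k} (hp : pᵀ ∈ Qs k) : ∃ P : M2 k, S0 k * p = P * S0 k := by
  obtain ⟨M, rfl⟩ := blk_surj p
  have h := hp.2
  rw [blk_transpose] at h
  obtain ⟨h1, h2, _⟩ := tri_blk h
  rw [Matrix.transpose_eq_zero] at h1 h2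
  refine ⟨M 0 0, ?_⟩
  rw [S0_blk, S0, mul_rb, h1, h2]
  simp

lemma qsT_S0' {p : M6 k} (hp : pᵀ ∈ Qs k) :
    ∃ P : M2 k, IsUnit P.det ∧ S0 k * p = P * S0 k := by
  obtain ⟨P, h⟩ := qsT_S0 hp
  have hi := qs_inv hp
  rw [← Matrix.transpose_nonsing_inv] at hi
  obtain ⟨P', h'⟩ := qsT_S0 hi
  refine ⟨P, ?_, h⟩
  have hd : IsUnit p.det := by
    have := gsp_det hp.1
    rwa [Matrix.det_transpose] at this
  have h3 : S0 k = P * P' * S0 k := by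
    calc S0 k = S0 k * p * p⁻¹ := by
          rw [Matrix.mul_assoc, Matrix.mul_nonsing_inv _ hd, Matrix.mul_one]
      _ = _ := by rw [h, Matrix.mul_assoc, h', Matrix.mul_assoc]
  rw [S0, mul_rb] at h3
  have h4 := (rb_inj h3).1
  rw [Matrix.mul_one] at h4
  exact Matrix.isUnit_det_of_right_inverse h4.symm

lemma qsT_of_S0 {p : M6 k} (hp : p ∈ GSp6 k) {P : M2 k} (hP : IsUnit P.det)
    (h : S0 k * p = P * S0 k) : pᵀ ∈ Qs k := by
  refine ⟨gsp_transpose hp, ?_⟩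
  obtain ⟨_, l, e⟩ := hp
  obtain ⟨M, rfl⟩ := blk_surj p
  rw [S0_blk, S0, mul_rb] at h
  obtain ⟨h0, h1, h2⟩ := rb_inj h
  rw [Matrix.mul_one] at h0
  rw [Matrix.mul_zero] at h1 h2
  rw [blk_transpose, J3, blk_mul, blk_mul, blk_smul] at e
  have e01 := congr_fun (congr_fun (blk_inj e) 0) 1
  simp [h0, h1, h2] at e01
  have hJ : IsUnit (Jmat : M2 k).det := by simp [Jmat]
  have hPJ : IsUnit (P * Jmat).det := by rw [Matrix.det_mul]; exact hP.mul hJ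
  have h3 : (M 1 2)ᵀ = 0 := by
    have := congrArg (fun x => (P * Jmat)⁻¹ * x) e01
    simpa only [← Matrix.mul_assoc, Matrix.nonsing_inv_mul _ hPJ, Matrix.one_mul,
      Matrix.mul_zero] using this
  rw [blk_transpose]
  exact blk_tri (by simp [h1]) (by simp [h2]) h3

lemma etaMat_transpose (v : M2 k) : (etaMat v)ᵀ = etaMat vᵀ := by
  rw [etaMat, etaMat, bdiag, bdiag, blk_transpose]
  apply blk_congr
  intro i j
  fin_cases i <;> fin_cases j <;> simp

lemma mem_D_iff (g σ : M6 k) : g ∈ setT (Sgrp k) * etaGL2 k * {σ} * etaGL2 k * Sgrp k ↔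
    ∃ p q : M6 k, pᵀ ∈ Qs k ∧ q ∈ Qs k ∧ g = p * σ * q := by
  constructor
  · rintro ⟨_, ⟨_, ⟨_, ⟨_, ⟨s, hs, rfl⟩, _, ⟨u, hu, rfl⟩, rfl⟩, _, rfl, rfl⟩,
      _, ⟨v, hv, rfl⟩, rfl⟩, s', hs', rfl⟩
    refine ⟨sᵀ * etaMat u, etaMat v * s', ?_, qs_mul (qs_eta hv) (qs_sgrp hs'), ?_⟩
    · rw [Matrix.transpose_mul, Matrix.transpose_transpose, etaMat_transpose]
      refine qs_mul (qs_eta ?_) (qs_sgrp hs)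
      rw [Matrix.isUnit_iff_isUnit_det, Matrix.det_transpose, ← Matrix.isUnit_iff_isUnit_det]
      exact hu
    · simp only [Matrix.mul_assoc]
  · rintro ⟨p, q, hp, hq, rfl⟩
    obtain ⟨u, hu, s, hs, e⟩ := qs_decomp hp
    obtain ⟨v, hv, s', hs', rfl⟩ := qs_decomp hq
    have e' : p = sᵀ * etaMat uᵀ := by
      rw [← etaMat_transpose, ← Matrix.transpose_mul, ← e, Matrix.transpose_transpose]
    have hu' : IsUnit uᵀ := by
      rw [Matrix.isUnit_iff_isUnit_det, Matrix.det_transpose, ← Matrix.isUnit_iff_isUnit_det]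
      exact hu
    rw [e', ← Matrix.mul_assoc]
    exact Set.mul_mem_mul (Set.mul_mem_mul (Set.mul_mem_mul (Set.mul_mem_mul ⟨s, hs, rfl⟩
      ⟨_, hu', rfl⟩) rfl) ⟨_, hv, rfl⟩) hs'

lemma gsp_amat : (amat : M6 k) ∈ GSp6 k := by
  have h : (Jmat : M2 k).det = 1 := by simp [Jmat]
  have := gsp_bdiag (t := (Jmat : M2 k)) (w := 1) (by simp [h]) (by simp)
  simpa [amat, h] using this

lemma gsp_cmat : (cmat : M6 k) ∈ GSp6 k := by
  have h : (Jmat : M2 k).det = 1 := by simp [Jmat]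
  have := gsp_bdiag (t := (1 : M2 k)) (w := Jmat) (by simp) (by simp [h])
  simpa [cmat, h] using this

lemma gsp_bmat : (bmat : M6 k) ∈ GSp6 k := by
  apply gsp_of_rel (l := 1) one_ne_zero
  rw [bmat_blk, blk_transpose, J3, blk_mul, blk_mul, blk_smul]
  apply blk_congr
  intro i j
  fin_cases i <;> fin_cases j <;> ext a b <;> fin_cases a <;> fin_cases b <;>
    simp [Jmat, Matrix.mul_apply, Fin.sum_univ_two, Matrix.vecMul, dotProduct]

lemma gsp_sigma {σ : M6 k} (h : σ ∈ SigmaSet k) : σ ∈ GSp6 k := by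
  have ha := gsp_amat (k := k)
  have hb := gsp_bmat (k := k)
  have hc := gsp_cmat (k := k)
  rcases h with rfl | rfl | rfl | rfl | rfl
  · exact qs_one.1
  · exact hb
  · exact gsp_mul (gsp_mul hb hc) hb
  · exact gsp_mul (gsp_mul (gsp_mul hb ha) hc) hb
  · exact gsp_mul (gsp_mul (gsp_mul (gsp_mul (gsp_mul (gsp_mul hb hc) ha) hb) ha) hc) hb

lemma mem_D_iff_rel {g σ : M6 k} (hg : g ∈ GSp6 k) (hσ : σ ∈ SigmaSet k) :
    g ∈ setT (Sgrp k) * etaGL2 k * {σ} * etaGL2 k * Sgrp k ↔ TRel (S0 k * σ) (S0 k * g) := by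
  rw [mem_D_iff]
  constructor
  · rintro ⟨p, q, hp, hq, rfl⟩
    obtain ⟨P, hP, h⟩ := qsT_S0' hp
    refine ⟨P, hP, q, hq, ?_⟩
    rw [← Matrix.mul_assoc, ← Matrix.mul_assoc, h, ← Matrix.mul_assoc]
  · rintro ⟨P, hP, q, hq, h⟩
    have hsq := gsp_mul (gsp_sigma hσ) hq.1
    have hd := gsp_det hsq
    refine ⟨g * (σ * q)⁻¹, q, qsT_of_S0 (gsp_mul hg (gsp_inv hsq)) hP ?_, hq, ?_⟩
    · rw [← Matrix.mul_assoc, h, Matrix.mul_assoc, Matrix.mul_assoc, Matrix.mul_assoc,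
        ← Matrix.mul_assoc σ, Matrix.mul_nonsing_inv _ hd, Matrix.mul_one]
    · rw [Matrix.mul_assoc, Matrix.mul_assoc, Matrix.nonsing_inv_mul _ hd, Matrix.mul_one]

/-- Projection to the first block column. -/
def E2 (k : Type*) [Field k] : M6 k := bdiag 1 0 0

/-- Projection to the first two block columns. -/
def E4 (k : Type*) [Field k] : M6 k := bdiag 1 1 0

lemma q_E2 {q : M6 k} (hq : q ∈ Qs k) : q * E2 k = E2 k * q * E2 k := by
  obtain ⟨M, rfl⟩ := blk_surj q
  obtain ⟨h1, h2, h3⟩ := tri_blk hq.2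
  rw [E2, bdiag, blk_mul, blk_mul, blk_mul]
  apply blk_congr
  intro i j
  fin_cases i <;> fin_cases j <;> simp [h1, h2, h3]

lemma q_E4 {q : M6 k} (hq : q ∈ Qs k) : q * E4 k = E4 k * q * E4 k := by
  obtain ⟨M, rfl⟩ := blk_surj q
  obtain ⟨h1, h2, h3⟩ := tri_blk hq.2
  rw [E4, bdiag, blk_mul, blk_mul, blk_mul]
  apply blk_congr
  intro i j
  fin_cases i <;> fin_cases j <;> simp [h1, h2, h3]

/-- `T * E` has a left kernel. -/
def Ker (E : M6 k) (T : Matrix (Fin 2) (Fin 6) k) : Prop :=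
  ∃ v : Fin 2 → k, v ≠ 0 ∧ v ᵥ* (T * E) = 0

lemma zero_rel {E : M6 k} (hE : ∀ q ∈ Qs k, q * E = E * q * E) {T T' : Matrix (Fin 2) (Fin 6) k}
    (h : TRel T T') (hT : T * E = 0) : T' * E = 0 := by
  obtain ⟨P, hP, q, hq, rfl⟩ := h
  rw [Matrix.mul_assoc, hE q hq, Matrix.mul_assoc, Matrix.mul_assoc, ← Matrix.mul_assoc T, hT]
  simp

lemma ker_rel {E : M6 k} (hE : ∀ q ∈ Qs k, q * E = E * q * E) {T T' : Matrix (Fin 2) (Fin 6) k}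
    (h : TRel T T') (hT : Ker E T) : Ker E T' := by
  obtain ⟨P, hP, q, hq, rfl⟩ := h
  obtain ⟨v, hv, h0⟩ := hT
  refine ⟨v ᵥ* P⁻¹, ?_, ?_⟩
  · intro h1
    exact hv (vec_cancel (Matrix.isUnit_nonsing_inv_det _ hP) h1)
  · have e : P⁻¹ * (P * T * q * E) = T * E * (q * E) := by
      calc P⁻¹ * (P * T * q * E) = P⁻¹ * P * T * (q * E) := by simp only [Matrix.mul_assoc]
        _ = T * (E * q * E) := by rw [Matrix.nonsing_inv_mul _ hP, Matrix.one_mul, hE q hq]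
        _ = T * E * (q * E) := by simp only [Matrix.mul_assoc]
    rw [Matrix.vecMul_vecMul, e, ← Matrix.vecMul_vecMul, h0, Matrix.zero_vecMul]

lemma rb_E2 (A B C : M2 k) : rb A B C * E2 k = rb A 0 0 := by
  rw [E2, rb_mul_bdiag]; simp

lemma rb_E4 (A B C : M2 k) : rb A B C * E4 k = rb A B 0 := by
  rw [E4, rb_mul_bdiag]; simp

lemma ker_of_row {E : M6 k} {T : Matrix (Fin 2) (Fin 6) k} {A B : M2 k}
    (h : T * E = rb A B 0) (hA : A 1 = 0) (hB : B 1 = 0) : Ker E T := by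
  refine ⟨![0, 1], ?_, ?_⟩
  · intro h'
    simpa using congr_fun h' 1
  · rw [h]
    apply vec_rb
    · ext j; simp [Matrix.vecMul, dotProduct, hA]
    · ext j; simp [Matrix.vecMul, dotProduct, hB]
    · simp

/-- The level of a representative. -/
lemma sigma_unique {σ τ : M6 k} (hσ : σ ∈ SigmaSet k) (hτ : τ ∈ SigmaSet k)
    (h : TRel (S0 k * σ) (S0 k * τ)) : σ = τ := by
  have n1 : ¬ Ker (E2 k) (S0 k * (1 : M6 k)) := by
    rintro ⟨v, hv, h0⟩
    rw [S1, rb_E2] at h0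
    apply hv
    simpa using (vec_rb' v h0).1
  have n2 : ¬ Ker (E4 k) (S0 k * (bmat : M6 k)) := by
    rintro ⟨v, hv, h0⟩
    rw [S2, rb_E4] at h0
    apply hv
    obtain ⟨h1, h2, _⟩ := vec_rb' v h0
    have h1' := congr_fun h1 0
    have h2' := congr_fun h2 0
    simp [Matrix.vecMul, dotProduct] at h1' h2'
    ext i
    fin_cases i
    · exact h1'
    · exact h2'
  have n3 : S0 k * ((bmat : M6 k) * cmat * bmat) * E2 k ≠ 0 := by
    rw [S3, rb_E2, ← rb_zero]
    intro h
    simpa using congr_fun (congr_fun (rb_inj h).1 0) 0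
  have n4 : S0 k * ((bmat : M6 k) * amat * cmat * bmat) * E4 k ≠ 0 := by
    rw [S4, rb_E4, ← rb_zero]
    intro h
    simpa using congr_fun (congr_fun (rb_inj h).2.1 0) 0
  have z4 : S0 k * ((bmat : M6 k) * amat * cmat * bmat) * E2 k = 0 := by
    rw [S4, rb_E2, rb_zero]
  have z5 : S0 k * ((bmat : M6 k) * cmat * amat * bmat * amat * cmat * bmat) * E2 k = 0 := by
    rw [S5, rb_E2, rb_zero]
  have y5 : S0 k * ((bmat : M6 k) * cmat * amat * bmat * amat * cmat * bmat) * E4 k = 0 := by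
    rw [S5, rb_E4, rb_zero]
  have r0 : ∀ a b : k, (!![a, b; 0, 0] : M2 k) 1 = 0 := by
    intro a b
    ext j
    fin_cases j <;> rfl
  have k2 : Ker (E2 k) (S0 k * (bmat : M6 k)) :=
    ker_of_row (by rw [S2, rb_E2]) (r0 _ _) rfl
  have k3 : Ker (E2 k) (S0 k * ((bmat : M6 k) * cmat * bmat)) :=
    ker_of_row (by rw [S3, rb_E2]) (r0 _ _) rfl
  have k4 : Ker (E2 k) (S0 k * ((bmat : M6 k) * amat * cmat * bmat)) :=
    ker_of_row (by rw [S4, rb_E2]) rfl rfl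
  have k5 : Ker (E2 k) (S0 k * ((bmat : M6 k) * cmat * amat * bmat * amat * cmat * bmat)) :=
    ker_of_row (by rw [S5, rb_E2]) rfl rfl
  have l3 : Ker (E4 k) (S0 k * ((bmat : M6 k) * cmat * bmat)) :=
    ker_of_row (by rw [S3, rb_E4]) (r0 _ _) rfl
  have l4 : Ker (E4 k) (S0 k * ((bmat : M6 k) * amat * cmat * bmat)) :=
    ker_of_row (by rw [S4, rb_E4]) rfl (r0 _ _)
  have l5 : Ker (E4 k) (S0 k * ((bmat : M6 k) * cmat * amat * bmat * amat * cmat * bmat)) :=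
    ker_of_row (by rw [S5, rb_E4]) rfl rfl
  have i1 : Ker (E2 k) (S0 k * σ) ↔ Ker (E2 k) (S0 k * τ) :=
    ⟨ker_rel (fun _ => q_E2) h, ker_rel (fun _ => q_E2) h.symm⟩
  have i2 : Ker (E4 k) (S0 k * σ) ↔ Ker (E4 k) (S0 k * τ) :=
    ⟨ker_rel (fun _ => q_E4) h, ker_rel (fun _ => q_E4) h.symm⟩
  have i3 : S0 k * σ * E2 k = 0 ↔ S0 k * τ * E2 k = 0 :=
    ⟨zero_rel (fun _ => q_E2) h, zero_rel (fun _ => q_E2) h.symm⟩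
  have i4 : S0 k * σ * E4 k = 0 ↔ S0 k * τ * E4 k = 0 :=
    ⟨zero_rel (fun _ => q_E4) h, zero_rel (fun _ => q_E4) h.symm⟩
  rcases hσ with rfl | rfl | rfl | rfl | rfl
  · rcases hτ with rfl | rfl | rfl | rfl | rfl
    · rfl
    · exact absurd (i1.2 k2) n1
    · exact absurd (i1.2 k3) n1
    · exact absurd (i1.2 k4) n1
    · exact absurd (i1.2 k5) n1
  · rcases hτ with rfl | rfl | rfl | rfl | rfl
    · exact absurd (i1.1 k2) n1
    · rfl
    · exact absurd (i2.2 l3) n2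
    · exact absurd (i2.2 l4) n2
    · exact absurd (i2.2 l5) n2
  · rcases hτ with rfl | rfl | rfl | rfl | rfl
    · exact absurd (i1.1 k3) n1
    · exact absurd (i2.1 l3) n2
    · rfl
    · exact absurd (i3.2 z4) n3
    · exact absurd (i3.2 z5) n3
  · rcases hτ with rfl | rfl | rfl | rfl | rfl
    · exact absurd (i1.1 k4) n1
    · exact absurd (i2.1 l4) n2
    · exact absurd (i3.1 z4) n3
    · rfl
    · exact absurd (i4.2 y5) n4
  · rcases hτ with rfl | rfl | rfl | rfl | rfl
    · exact absurd (i1.1 k5) n1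
    · exact absurd (i2.1 l5) n2
    · exact absurd (i3.1 z5) n3
    · exact absurd (i4.1 y5) n4
    · rfl

/-- `GSp6(k)` is the disjoint union over `σ ∈ Σ` of the sets
`Sᵀ·η(GL2)·σ·η(GL2)·S`: every `g ∈ GSp6(k)` lies in `Sᵀ·η(GL2)·σ·η(GL2)·S` for exactly one
`σ ∈ Σ = {1, b, bcb, bacb, bcabacb}`. -/
theorem gsp6_shalika_double_coset_decomposition (k : Type*) [Field k] :
    ∀ g ∈ GSp6 k, ∃! σ : M6 k, σ ∈ SigmaSet k ∧
      g ∈ setT (Sgrp k) * etaGL2 k * {σ} * etaGL2 k * Sgrp k := by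
  intro g hg
  obtain ⟨σ, hσ, r⟩ := reaches_all _ (good_S0 hg)
  refine ⟨σ, ⟨hσ, (mem_D_iff_rel hg hσ).2 r⟩, ?_⟩
  rintro τ ⟨hτ, hm⟩
  exact sigma_unique hτ hσ (((mem_D_iff_rel hg hτ).1 hm).trans r.symm)
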